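/- arXiv:1607.03798 — 2 statements merged into one kernel-verified Lean document; each statement's English description precedes it below -/
import Mathlib

section
/- Let G ≤ Sym(Ω) be a semiprimitive permutation group. (1) If N is a normal subgroup of G that is not semiregular (i.e. N_ω ≠ 1 for some ω ∈ Ω), then N contains every plinth of G. (2) If K and L are two distinct plinths of G, then every plinth of G is contained in the product KL. -/
open Pointwise

def IsTransitiveOn {G : Type*} [Group G] (N : Subgroup G) (Ω : Type*) [MulAction G Ω] : Prop :=
  ∀ a b : Ω, ∃ n ∈ N, n • a = b

def IsSemiregularOn {G : Type*} [Group G] (N : Subgroup G) (Ω : Type*) [MulAction G Ω] : Prop :=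
  ∀ n ∈ N, (∃ a : Ω, n • a = a) → n = 1

def IsSemiprimitive (G Ω : Type*) [Group G] [MulAction G Ω] : Prop :=
  IsTransitiveOn (⊤ : Subgroup G) Ω ∧
    ∀ N : Subgroup G, N.Normal → IsTransitiveOn N Ω ∨ IsSemiregularOn N Ω

def IsPlinth {G : Type*} [Group G] (K : Subgroup G) (Ω : Type*) [MulAction G Ω] : Prop :=
  K.Normal ∧ IsTransitiveOn K Ω ∧
    ∀ N : Subgroup G, N.Normal → N < K → ¬ IsTransitiveOn N Ω

/-- The subgroup of all `g` that map every point into its own `M`-orbit: the kernel of the action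
on the set of `M`-orbits. -/
def orbitKernel {G : Type*} [Group G] (M : Subgroup G) (Ω : Type*) [MulAction G Ω] :
    Subgroup G where
  carrier := {g | ∀ x : Ω, ∃ m ∈ M, m • x = g • x}
  one_mem' x := ⟨1, M.one_mem, rfl⟩
  mul_mem' {g h} hg hh x := by
    obtain ⟨m, hm, hmx⟩ := hh x
    obtain ⟨m', hm', hmx'⟩ := hg (h • x)
    exact ⟨m' * m, M.mul_mem hm' hm, by rw [mul_smul, hmx, hmx', mul_smul]⟩
  inv_mem' {g} hg x := by
    obtain ⟨m, hm, hmx⟩ := hg (g⁻¹ • x)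
    refine ⟨m⁻¹, M.inv_mem hm, ?_⟩
    rw [smul_inv_smul] at hmx
    rw [inv_smul_eq_iff, hmx]

theorem orbitKernel_normal {G : Type*} [Group G] {M : Subgroup G} (hM : M.Normal)
    (Ω : Type*) [MulAction G Ω] : (orbitKernel M Ω).Normal where
  conj_mem g hg c x := by
    obtain ⟨m, hm, hmx⟩ := hg (c⁻¹ • x)
    exact ⟨c * m * c⁻¹, hM.conj_mem m hm c, by simp only [mul_smul, hmx]⟩

theorem IsTransitiveOn.of_orbitKernel {G Ω : Type*} [Group G] [MulAction G Ω] {M : Subgroup G}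
    (h : IsTransitiveOn (orbitKernel M Ω) Ω) : IsTransitiveOn M Ω := by
  intro a b
  obtain ⟨g, hg, rfl⟩ := h a b
  exact hg a

/-- If `K` and `N` are normal and `K` is transitive, every element of `N` with a
fixed point preserves each orbit of `K ⊓ N`. -/
theorem mem_orbitKernel_inf_of_smul_eq {G Ω : Type*} [Group G] [MulAction G Ω]
    {K N : Subgroup G} (hK : K.Normal) (hN : N.Normal) (hKt : IsTransitiveOn K Ω)
    {n : G} (hn : n ∈ N) {a : Ω} (ha : n • a = a) : n ∈ orbitKernel (K ⊓ N) Ω := by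
  intro x
  obtain ⟨k, hk, rfl⟩ := hKt a x
  refine ⟨n * k * n⁻¹ * k⁻¹,
    Subgroup.mem_inf.2 ⟨K.mul_mem (hK.conj_mem k hk n) (K.inv_mem hk), ?_⟩, ?_⟩
  · simpa only [mul_assoc] using N.mul_mem hn (hN.conj_mem n⁻¹ (N.inv_mem hn) k)
  · have ha' : n⁻¹ • a = a := inv_smul_eq_iff.2 ha.symm
    simp only [mul_smul, inv_smul_smul, ha']

theorem IsPlinth.le_of_not_isSemiregularOn {G Ω : Type*} [Group G] [MulAction G Ω]
    (hG : IsSemiprimitive G Ω) {K N : Subgroup G} (hK : IsPlinth K Ω) (hN : N.Normal)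
    (hNs : ¬ IsSemiregularOn N Ω) : K ≤ N := by
  obtain ⟨hKn, hKt, hKmin⟩ := hK
  have hM : (K ⊓ N).Normal := inferInstance
  by_contra hle
  have hMt : ¬ IsTransitiveOn (K ⊓ N) Ω := hKmin _ hM (inf_lt_left.2 hle)
  obtain hB | hB := hG.2 _ (orbitKernel_normal hM Ω)
  · exact hMt hB.of_orbitKernel
  · exact hNs fun n hn ⟨a, ha⟩ =>
      hB n (mem_orbitKernel_inf_of_smul_eq hKn hN hKt hn ha) ⟨a, ha⟩

/-- A transitive subgroup of a semiregular group is the whole group. -/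
theorem IsSemiregularOn.eq_of_le {G Ω : Type*} [Group G] [MulAction G Ω] [Nonempty Ω]
    {H K : Subgroup G} (hH : IsSemiregularOn H Ω) (hK : IsTransitiveOn K Ω) (hle : K ≤ H) :
    K = H := by
  refine le_antisymm hle fun g hg => ?_
  obtain ⟨a⟩ := ‹Nonempty Ω›
  obtain ⟨k, hk, hka⟩ := hK a (g • a)
  have h : k⁻¹ * g = 1 :=
    hH _ (H.mul_mem (H.inv_mem (hle hk)) hg) ⟨a, by rw [mul_smul, ← hka, inv_smul_smul]⟩
  rwa [← inv_mul_eq_one.1 h]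

/-- Let `G ≤ Sym(Ω)` be semiprimitive. (1) Every non-semiregular normal subgroup of `G`
contains every plinth of `G`. (2) If `K` and `L` are two distinct plinths of `G`, then every
plinth of `G` is contained in `KL`. -/
theorem stmt4 {G Ω : Type*} [Group G] [MulAction G Ω] [FaithfulSMul G Ω]
    (hG : IsSemiprimitive G Ω) :
    (∀ N : Subgroup G, N.Normal → ¬ IsSemiregularOn N Ω →
      ∀ K : Subgroup G, IsPlinth K Ω → K ≤ N) ∧
    (∀ K L : Subgroup G, IsPlinth K Ω → IsPlinth L Ω → K ≠ L →
      ∀ P : Subgroup G, IsPlinth P Ω → P ≤ K ⊔ L) := by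
  refine ⟨fun N hN hNs K hK => hK.le_of_not_isSemiregularOn hG hN hNs,
    fun K L hK hL hKL P hP => ?_⟩
  obtain hΩ | hΩ := isEmpty_or_nonempty Ω
  · intro g _
    have hg : g = 1 := FaithfulSMul.eq_of_smul_eq_smul fun a : Ω => hΩ.elim a
    exact hg ▸ one_mem _
  · have := hK.1
    have := hL.1
    refine hP.le_of_not_isSemiregularOn hG (Subgroup.sup_normal K L) fun hs => hKL ?_
    exact (hs.eq_of_le hK.2.1 le_sup_left).trans (hs.eq_of_le hL.2.1 le_sup_right).symm
end

section
/- Let G ≤ Sym(Ω) be a transitive permutation group having two distinct minimal normal subgroups L and R that are both transitive. Then G is primitive, L and R are regular, L and R are the only minimal normal subgroups of G, and there is a non-abelian characteristically simple group X with X ≅ L ≅ R ≅ (LR)_α for any α ∈ Ω, where (LR)_α is the point-stabiliser of α in the product LR. -/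
open Pointwise

/-- `N` is a minimal normal subgroup. -/
def IsMinimalNormal {G : Type*} [Group G] (N : Subgroup G) : Prop :=
  N.Normal ∧ N ≠ ⊥ ∧ ∀ N' : Subgroup G, N'.Normal → N' ≤ N → N' = ⊥ ∨ N' = N

/-- The action of `G` on `Ω` is primitive: transitive, and every `G`-invariant partition of
`Ω` is trivial. -/
def IsPrimitiveAction (G Ω : Type*) [Group G] [MulAction G Ω] : Prop :=
  (∀ a b : Ω, ∃ g : G, g • a = b) ∧
    ∀ P : Set (Set Ω), Setoid.IsPartition P → (∀ p ∈ P, ∀ g : G, g • p ∈ P) →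
      (∀ p ∈ P, ∃ ω : Ω, p = {ω}) ∨ P = {Set.univ}

/-- A group is characteristically simple if it is non-trivial and its only characteristic
subgroups are trivial. -/
def IsCharSimple (X : Type*) [Group X] : Prop :=
  Nontrivial X ∧ ∀ H : Subgroup X, H.Characteristic → H = ⊥ ∨ H = ⊤

section

variable {G Ω : Type*} [Group G] [MulAction G Ω] {L R : Subgroup G}

theorem IsMinimalNormal.disjoint (hL : IsMinimalNormal L) (hR : IsMinimalNormal R) (hne : L ≠ R) :
    Disjoint L R := by
  have := hL.1
  have := hR.1
  rw [disjoint_iff]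
  rcases hL.2.2 (L ⊓ R) inferInstance inf_le_left with h | h
  · exact h
  · rcases hR.2.2 L hL.1 (inf_eq_left.mp h) with h | h
    · exact absurd h hL.2.1
    · exact absurd h hne

theorem IsMinimalNormal.le_centralizer (hL : IsMinimalNormal L) (hR : IsMinimalNormal R)
    (hne : L ≠ R) : L ≤ Subgroup.centralizer (R : Set G) := fun l hl r hr =>
  (Subgroup.commute_of_normal_of_disjoint L R hL.1 hR.1 (hL.disjoint hR hne) l r hl hr).symm

theorem IsTransitiveOn.isSemiregularOn_centralizer [FaithfulSMul G Ω] (hL : IsTransitiveOn L Ω) :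
    IsSemiregularOn (Subgroup.centralizer (L : Set G)) Ω := by
  rintro c hc ⟨a, ha⟩
  refine FaithfulSMul.eq_of_smul_eq_smul (α := Ω) fun b => ?_
  obtain ⟨l, hl, rfl⟩ := hL a b
  rw [smul_smul, ← hc l hl, mul_smul, ha, one_smul]

theorem IsSemiregularOn.mono {K : Subgroup G} (hK : IsSemiregularOn K Ω) (h : L ≤ K) :
    IsSemiregularOn L Ω := fun n hn => hK n (h hn)

theorem IsSemiregularOn.eq_of_smul_eq (hL : IsSemiregularOn L Ω) {x y : G} (hx : x ∈ L)
    (hy : y ∈ L) {a : Ω} (h : x • a = y • a) : x = y := by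
  have := hL (y⁻¹ * x) (L.mul_mem (L.inv_mem hy) hx) ⟨a, by rw [mul_smul, h, inv_smul_smul]⟩
  exact (inv_mul_eq_one.mp this).symm

/-- A transitive subgroup of a semiregular group is the whole group. -/
theorem IsSemiregularOn.le_of_isTransitiveOn [Nonempty Ω] {K : Subgroup G}
    (hK : IsSemiregularOn K Ω) (hR : IsTransitiveOn R Ω) (hRK : R ≤ K) : K ≤ R := by
  intro k hk
  obtain ⟨a⟩ := ‹Nonempty Ω›
  obtain ⟨r, hr, h⟩ := hR a (k • a)
  rwa [← hK.eq_of_smul_eq (hRK hr) hk h]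

/-- A minimal normal subgroup is characteristically simple. -/
theorem IsMinimalNormal.isCharSimple (hL : IsMinimalNormal L) : IsCharSimple L := by
  refine ⟨(Subgroup.nontrivial_iff_ne_bot L).mpr hL.2.1, fun H hH => ?_⟩
  have := hL.1
  rcases hL.2.2 (H.map L.subtype) inferInstance (Subgroup.map_subtype_le H) with h | h
  · exact Or.inl ((Subgroup.map_eq_bot_iff_of_injective H L.subtype_injective).mp h)
  · refine Or.inr (Subgroup.map_injective L.subtype_injective ?_)
    rw [h, ← MonoidHom.range_eq_map, Subgroup.range_subtype]

/-- If `L` and `R` commute and are regular, then `l ↦ r`, where `l * r` fixes `α`, is an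
isomorphism, and so is `l ↦ l * r` onto the stabiliser of `α` in `L ⊔ R`. -/
theorem exists_mulEquiv_of_regular (hcomm : L ≤ Subgroup.centralizer (R : Set G))
    (hdisj : Disjoint L R) (hRnormal : R.Normal)
    (hLt : IsTransitiveOn L Ω) (hRt : IsTransitiveOn R Ω)
    (hLs : IsSemiregularOn L Ω) (hRs : IsSemiregularOn R Ω) (α : Ω) :
    Nonempty (L ≃* R) ∧ Nonempty (L ≃* ↥((L ⊔ R) ⊓ MulAction.stabilizer G α)) := by
  have hex : ∀ l : L, ∃ r : R, (r : G) • α = (l : G)⁻¹ • α := fun l => by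
    obtain ⟨r, hr, h⟩ := hRt α ((l : G)⁻¹ • α)
    exact ⟨⟨r, hr⟩, h⟩
  choose f hf using hex
  have huniq : ∀ (l : L) (r : R), ((l : G) * r) • α = α → f l = r := fun l r h => by
    refine Subtype.ext (hRs.eq_of_smul_eq (f l).2 r.2 (a := α) ?_)
    rw [hf, inv_smul_eq_iff, ← mul_smul, h]
  have hfix : ∀ l : L, ((l : G) * f l) • α = α := fun l => by
    rw [mul_smul, hf, smul_inv_smul]
  have hswap : ∀ a b : L, (a * b : G) * (f a * f b) = (a * f a) * (b * f b) := fun a b => by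
    have := hcomm b.2 (f a) (f a).2
    simp only [mul_assoc]
    rw [← mul_assoc (b : G), ← this, mul_assoc]
  have hmul : ∀ a b : L, f (a * b) = f a * f b := fun a b => by
    refine huniq _ _ ?_
    rw [Subgroup.coe_mul, Subgroup.coe_mul, hswap, mul_smul, hfix, hfix]
  let g : L →* ↥((L ⊔ R) ⊓ MulAction.stabilizer G α) :=
    MonoidHom.mk' (fun l => ⟨(l : G) * f l, Subgroup.mul_mem_sup l.2 (f l).2, hfix l⟩)
      fun a b => Subtype.ext (by simp only [Subgroup.coe_mul, hmul, hswap])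
  refine ⟨⟨MulEquiv.ofBijective (MonoidHom.mk' f hmul) ⟨fun a b h => ?_, fun r => ?_⟩⟩,
    ⟨MulEquiv.ofBijective g ⟨fun a b h => ?_, ?_⟩⟩⟩
  · replace h : f a = f b := h
    refine inv_injective (Subtype.ext (hLs.eq_of_smul_eq (a⁻¹).2 (b⁻¹).2 (a := α) ?_))
    rw [Subgroup.coe_inv, Subgroup.coe_inv, ← hf, ← hf, h]
  · obtain ⟨l, hl, h⟩ := hLt ((r : G) • α) α
    exact ⟨⟨l, hl⟩, huniq _ _ (by rw [mul_smul, h])⟩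
  · have h' : (a : G) * f a = b * f b := congrArg Subtype.val h
    have h1 : (b : G)⁻¹ * a = f b * (f a : G)⁻¹ := by
      rw [inv_mul_eq_iff_eq_mul, ← mul_assoc, ← h', mul_inv_cancel_right]
    have h2 : (b : G)⁻¹ * a = 1 := Subgroup.disjoint_def.mp hdisj
      (L.mul_mem (L.inv_mem b.2) a.2) (h1 ▸ R.mul_mem (f b).2 (R.inv_mem (f a).2))
    exact Subtype.ext (inv_mul_eq_one.mp h2).symm
  · rintro ⟨x, hx, hxα⟩
    obtain ⟨l, hl, r, hr, rfl⟩ := Subgroup.mem_sup_of_normal_right.mp hx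
    refine ⟨⟨l, hl⟩, Subtype.ext ?_⟩
    have := huniq ⟨l, hl⟩ ⟨r, hr⟩ hxα
    change l * (f ⟨l, hl⟩ : G) = l * r
    rw [this]

/-- If a minimal normal subgroup is transitive and is centralised by a transitive subgroup, then
the action is primitive. -/
theorem IsMinimalNormal.isPrimitiveAction (hL : IsMinimalNormal L)
    (hcomm : R ≤ Subgroup.centralizer (L : Set G))
    (hLt : IsTransitiveOn L Ω) (hRt : IsTransitiveOn R Ω) : IsPrimitiveAction G Ω := by
  refine ⟨fun a b => (hLt a b).imp fun _ h => h.2, fun P hP hinv => ?_⟩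
  have huniq : ∀ {p q : Set Ω} {a : Ω}, p ∈ P → q ∈ P → a ∈ p → a ∈ q → p = q :=
    fun hp hq hap haq => (hP.2 _).unique ⟨hp, hap⟩ ⟨hq, haq⟩
  have hstab : ∀ {p : Set Ω} {a : Ω} {g : G}, p ∈ P → a ∈ p → g • a ∈ p → g • p = p :=
    fun hp ha hga => huniq (hinv _ hp _) hp (Set.smul_mem_smul_set ha) hga
  have hblock : ∀ p ∈ P, (∃ ω : Ω, p = {ω}) ∨ p = Set.univ := by
    intro p hp
    obtain ⟨a, ha⟩ := Setoid.nonempty_of_mem_partition hP hp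
    have hnormal : (L ⊓ MulAction.stabilizer G p).Normal := by
      refine ⟨fun n hn g => ⟨hL.1.conj_mem n hn.1 g, ?_⟩⟩
      obtain ⟨r, hr, hra⟩ := hRt a (g⁻¹ • a)
      have hgr : g * r ∈ MulAction.stabilizer G p :=
        hstab hp ha (by rw [mul_smul, hra, smul_inv_smul]; exact ha)
      have hconj : g * n * g⁻¹ = (g * r) * n * (g * r)⁻¹ := by
        have : n * r = r * n := hcomm hr n hn.1
        rw [mul_assoc g r n, ← this]
        group
      rw [hconj]
      exact Subgroup.mul_mem _ (Subgroup.mul_mem _ hgr hn.2) (Subgroup.inv_mem _ hgr)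
    rcases hL.2.2 _ hnormal inf_le_left with h | h
    · refine Or.inl ⟨a, Set.eq_singleton_iff_unique_mem.mpr ⟨ha, fun b hb => ?_⟩⟩
      obtain ⟨l, hl, rfl⟩ := hLt a b
      have hl1 : l ∈ L ⊓ MulAction.stabilizer G p := ⟨hl, hstab hp ha hb⟩
      rw [h, Subgroup.mem_bot] at hl1
      rw [hl1, one_smul]
    · refine Or.inr (Set.eq_univ_of_forall fun b => ?_)
      obtain ⟨l, hl, rfl⟩ := hLt a b
      have hlp : l • p = p := (inf_eq_left.mp h) hl
      rw [← hlp]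
      exact Set.smul_mem_smul_set ha
  by_cases huniv : Set.univ ∈ P
  · refine Or.inr (Set.eq_singleton_iff_unique_mem.mpr ⟨huniv, fun p hp => ?_⟩)
    obtain ⟨a, ha⟩ := Setoid.nonempty_of_mem_partition hP hp
    exact huniq hp huniv ha trivial
  · exact Or.inl fun p hp => (hblock p hp).resolve_right fun h => huniv (h ▸ hp)

end

/-- If a transitive group `G ≤ Sym(Ω)` has two distinct transitive minimal normal subgroups
`L` and `R`, then `G` is primitive, `L` and `R` are regular and are the only minimal normal
subgroups of `G`, and there is a non-abelian characteristically simple group `X` with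
`X ≅ L ≅ R ≅ (LR)_α` for every `α ∈ Ω`. -/
theorem stmt10 {G : Type u} {Ω : Type*} [Group G] [MulAction G Ω] [FaithfulSMul G Ω]
    (htrans : IsTransitiveOn (⊤ : Subgroup G) Ω)
    (L R : Subgroup G) (hL : IsMinimalNormal L) (hR : IsMinimalNormal R)
    (hLtrans : IsTransitiveOn L Ω) (hRtrans : IsTransitiveOn R Ω) (hLR : L ≠ R) :
    IsPrimitiveAction G Ω ∧
    (IsTransitiveOn L Ω ∧ IsSemiregularOn L Ω) ∧
    (IsTransitiveOn R Ω ∧ IsSemiregularOn R Ω) ∧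
    (∀ N : Subgroup G, IsMinimalNormal N → N = L ∨ N = R) ∧
    ∃ (X : Type u) (_ : Group X), IsCharSimple X ∧ (¬ ∀ x y : X, x * y = y * x) ∧
      Nonempty (X ≃* ↥L) ∧ Nonempty (X ≃* ↥R) ∧
      ∀ α : Ω, Nonempty (X ≃* ↥((L ⊔ R) ⊓ MulAction.stabilizer G α)) := by
  have hdisj := hL.disjoint hR hLR
  have hLcR := hL.le_centralizer hR hLR
  have hRcL := hR.le_centralizer hL hLR.symm
  have hLs := hRtrans.isSemiregularOn_centralizer.mono hLcR
  have hRs := hLtrans.isSemiregularOn_centralizer.mono hRcL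
  have hΩ : Nonempty Ω := by
    by_contra h
    rw [not_nonempty_iff] at h
    exact hL.2.1 ((Subgroup.eq_bot_iff_forall L).mpr fun l _ =>
      FaithfulSMul.eq_of_smul_eq_smul (α := Ω) fun a => isEmptyElim a)
  have hcL : Subgroup.centralizer (L : Set G) ≤ R :=
    hLtrans.isSemiregularOn_centralizer.le_of_isTransitiveOn hRtrans hRcL
  have hequiv := exists_mulEquiv_of_regular hLcR hdisj hR.1 hLtrans hRtrans hLs hRs
  refine ⟨hL.isPrimitiveAction hRcL hLtrans hRtrans, ⟨hLtrans, hLs⟩, ⟨hRtrans, hRs⟩,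
    fun N hN => ?_, L, inferInstance, hL.isCharSimple, fun hab => ?_, ⟨MulEquiv.refl L⟩,
    (hequiv hΩ.some).1, fun α => (hequiv α).2⟩
  · by_cases hNL : N = L
    · exact Or.inl hNL
    · exact Or.inr ((hR.2.2 N hN.1 ((hN.le_centralizer hL hNL).trans hcL)).resolve_left hN.2.1)
  · have hLR' : L ≤ R := fun l hl =>
      hcL fun m hm => congrArg Subtype.val (hab ⟨m, hm⟩ ⟨l, hl⟩)
    exact hL.2.1 (hdisj.eq_bot_of_le hLR')
end
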